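/- Let n, N ≥ 1 and d ≥ 1 be integers, let p_1, …, p_N and q_1, …, q_N be real polynomials in n variables of total degree at most d, let Ω = {x ∈ ℝ^n : q_i(x) ≠ 0 for all i}, and let f : Ω → ℝ^N be the rational map f(x) = (p_1(x)/q_1(x), …, p_N(x)/q_N(x)). Then for every affine subspace L ⊆ ℝ^N, the set f(Ω) ∩ L, equipped with the subspace topology, has at most (2Nd+1)^{n+1} connected components. -/

import Mathlib

/-- The rational map `ℝ^n ⊇ Ω → ℝ^N` with coordinate functions `pᵢ/qᵢ`. -/
noncomputable def ratMap {n N : ℕ} (p q : Fin N → MvPolynomial (Fin n) ℝ)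
    (x : Fin n → ℝ) : EuclideanSpace ℝ (Fin N) :=
  WithLp.toLp 2 fun i => MvPolynomial.eval x (p i) / MvPolynomial.eval x (q i)

open MvPolynomial Filter Topology

theorem exists_mul_lt_of_polynomial_growth (N : ℕ → ℕ) (m M E : ℕ) (h0 : 1 ≤ N 0)
    (hN : ∀ k, N k ≤ (k + 1) ^ m) : ∃ T, M * N (T + E) < (M + 1) * N T := by
  by_contra! h
  have hM : 0 < M := by
    rcases Nat.eq_zero_or_pos M with rfl | hM
    · have := h 0
      omega
    · exact hM
  have hpow : ∀ j, (M + 1) ^ j ≤ M ^ j * N (j * E) := by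
    intro j
    induction j with
    | zero => simpa using h0
    | succ j ih =>
      calc (M + 1) ^ (j + 1) = (M + 1) * (M + 1) ^ j := by ring
        _ ≤ (M + 1) * (M ^ j * N (j * E)) := Nat.mul_le_mul_left _ ih
        _ = M ^ j * ((M + 1) * N (j * E)) := by ring
        _ ≤ M ^ j * (M * N (j * E + E)) := Nat.mul_le_mul_left _ (h _)
        _ = M ^ (j + 1) * N ((j + 1) * E) := by ring_nf
  have hM' : (0 : ℝ) < M := by exact_mod_cast hM
  set r : ℝ := (M + 1) / M with hr
  have hr1 : 1 < r := by rw [hr, one_lt_div hM']; linarith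
  have hE : (0 : ℝ) < ((E : ℝ) + 1) ^ m := by positivity
  have hlim := (tendsto_pow_const_div_const_pow_of_one_lt m hr1).eventually
    (gt_mem_nhds (inv_pos.2 hE))
  obtain ⟨j, hj, hj1⟩ := (hlim.and (eventually_ge_atTop 1)).exists
  have h1 : r ^ j ≤ ((E : ℝ) + 1) ^ m * (j : ℝ) ^ m := by
    rw [hr, div_pow, div_le_iff₀ (by positivity), ← mul_pow, mul_comm]
    have h2 : (M + 1) ^ j ≤ M ^ j * ((E + 1) * j) ^ m :=
      (hpow j).trans (Nat.mul_le_mul_left _ ((hN _).trans (Nat.pow_le_pow_left (by nlinarith) _)))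
    exact_mod_cast h2
  rw [div_lt_iff₀ (by positivity), ← div_eq_inv_mul, lt_div_iff₀ hE] at hj
  linarith

/-- The number of monomials of degree at most `k` in the variables `σ`. -/
noncomputable def monomialCount (σ : Type*) [Fintype σ] (k : ℕ) : ℕ :=
  Nat.card {a : σ → ℕ // ∑ i, a i ≤ k}

/-- Monomials of degree at most `k` have exponents at most `k`. -/
def monomialToBox (σ : Type*) [Fintype σ] (k : ℕ) (a : {a : σ → ℕ // ∑ i, a i ≤ k}) :
    σ → Fin (k + 1) :=
  fun i => ⟨a.1 i, Nat.lt_succ_of_le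
    ((Finset.single_le_sum (fun _ _ => Nat.zero_le _) (Finset.mem_univ i)).trans a.2)⟩

theorem monomialToBox_injective (σ : Type*) [Fintype σ] (k : ℕ) :
    Function.Injective (monomialToBox σ k) := fun _ _ h =>
  Subtype.ext (funext fun i => congrArg Fin.val (congrFun h i))

instance (σ : Type*) [Fintype σ] (k : ℕ) : Finite {a : σ → ℕ // ∑ i, a i ≤ k} :=
  Finite.of_injective _ (monomialToBox_injective σ k)

theorem monomialCount_le_pow (σ : Type*) [Fintype σ] (k : ℕ) :
    monomialCount σ k ≤ (k + 1) ^ Fintype.card σ := by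
  classical
  simpa [monomialCount] using
    Nat.card_le_card_of_injective _ (monomialToBox_injective σ k)

theorem one_le_monomialCount (σ : Type*) [Fintype σ] (k : ℕ) : 1 ≤ monomialCount σ k :=
  haveI : Nonempty {a : σ → ℕ // ∑ i, a i ≤ k} := ⟨⟨0, by simp⟩⟩
  Nat.card_pos

theorem monomialCount_mul_add_le (σ : Type*) [Fintype σ] {r : ℕ} (hr : 1 ≤ r) (T E : ℕ) :
    monomialCount σ (r * T + E) ≤ r ^ Fintype.card σ * monomialCount σ (T + E) := by
  classical
  let φ : {a : σ → ℕ // ∑ i, a i ≤ r * T + E} →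
      (σ → Fin r) × {a : σ → ℕ // ∑ i, a i ≤ T + E} := fun a =>
    (fun i => ⟨a.1 i % r, Nat.mod_lt _ hr⟩, ⟨fun i => a.1 i / r, by
      have h1 : r * ∑ i, a.1 i / r ≤ r * (T + E) := by
        rw [Finset.mul_sum]
        calc ∑ i, r * (a.1 i / r) ≤ ∑ i, a.1 i :=
              Finset.sum_le_sum fun i _ => Nat.mul_div_le _ _
          _ ≤ r * T + E := a.2
          _ ≤ r * (T + E) := by nlinarith
      exact Nat.le_of_mul_le_mul_left h1 hr⟩)
  have hφ : Function.Injective φ := by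
    intro a b h
    ext i
    have h1 : a.1 i % r = b.1 i % r := congrArg Fin.val (congrFun (congrArg Prod.fst h) i)
    have h2 : a.1 i / r = b.1 i / r := congrFun (congrArg (fun z => z.2.1) h) i
    rw [← Nat.div_add_mod (a.1 i) r, ← Nat.div_add_mod (b.1 i) r, h1, h2]
  simpa [monomialCount, Nat.card_prod] using Nat.card_le_card_of_injective φ hφ

theorem finrank_restrictTotalDegree (σ : Type*) [Fintype σ] (k : ℕ) :
    Module.finrank ℝ (restrictTotalDegree σ ℝ k) = monomialCount σ k := by
  refine (Module.finrank_eq_nat_card_basis (basisRestrictSupport ℝ _)).trans ?_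
  refine Nat.card_congr (Finsupp.equivFunOnFinite.subtypeEquiv fun a => ?_)
  simp [Finsupp.sum_fintype]

theorem totalDegree_aeval_le {σ τ : Type*} (f : σ → MvPolynomial τ ℝ) {r : ℕ}
    (hf : ∀ i, (f i).totalDegree ≤ r) (g : MvPolynomial σ ℝ) :
    (aeval f g).totalDegree ≤ r * g.totalDegree := by
  rw [aeval_def, eval₂_eq]
  refine totalDegree_finsetSum_le fun a ha => (totalDegree_mul _ _).trans ?_
  have h1 : (∏ i ∈ a.support, f i ^ a i).totalDegree ≤ r * g.totalDegree := by
    refine (totalDegree_finsetProd _ _).trans ?_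
    calc ∑ i ∈ a.support, (f i ^ a i).totalDegree ≤ ∑ i ∈ a.support, r * a i := by
          refine Finset.sum_le_sum fun i _ => (totalDegree_pow _ _).trans ?_
          rw [mul_comm]
          exact Nat.mul_le_mul_right _ (hf i)
      _ = r * a.sum fun _ e => e := by rw [← Finset.mul_sum, Finsupp.sum]
      _ ≤ r * g.totalDegree := Nat.mul_le_mul_left _ (le_totalDegree ha)
  simpa [algebraMap_eq] using h1

/-- A polynomial `u` satisfies a nontrivial polynomial relation of degree at most `r ^ card σ`
over the algebra generated by `card σ` polynomials of degree at most `r`. -/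
theorem exists_relation {σ : Type*} [Fintype σ] (f : σ → MvPolynomial σ ℝ) {r : ℕ}
    (hr : 1 ≤ r) (hf : ∀ i, (f i).totalDegree ≤ r) (u : MvPolynomial σ ℝ) :
    ∃ g : Fin (r ^ Fintype.card σ + 1) → MvPolynomial σ ℝ, g ≠ 0 ∧
      ∑ j, aeval f (g j) * u ^ (j : ℕ) = 0 := by
  set M := r ^ Fintype.card σ with hM
  obtain ⟨T, hT⟩ := exists_mul_lt_of_polynomial_growth (monomialCount σ) (Fintype.card σ) M
    (M * u.totalDegree) (one_le_monomialCount σ 0) (monomialCount_le_pow σ)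
  let Ψ : (Fin (M + 1) → restrictTotalDegree σ ℝ T) →ₗ[ℝ] MvPolynomial σ ℝ :=
    ∑ j : Fin (M + 1), (LinearMap.mulRight ℝ (u ^ (j : ℕ))) ∘ₗ (aeval f).toLinearMap ∘ₗ
      (restrictTotalDegree σ ℝ T).subtype ∘ₗ LinearMap.proj j
  have hΨ : ∀ g, Ψ g = ∑ j, aeval f (g j : MvPolynomial σ ℝ) * u ^ (j : ℕ) := fun g => by
    simp [Ψ]
  have hmem : ∀ g, Ψ g ∈ restrictTotalDegree σ ℝ (r * T + M * u.totalDegree) := by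
    intro g
    rw [mem_restrictTotalDegree, hΨ]
    refine totalDegree_finsetSum_le fun j _ => (totalDegree_mul _ _).trans (add_le_add ?_ ?_)
    · exact (totalDegree_aeval_le f hf _).trans
        (Nat.mul_le_mul_left _ ((mem_restrictTotalDegree _ _ _).1 (g j).2))
    · exact (totalDegree_pow _ _).trans (Nat.mul_le_mul_right _ (Nat.lt_succ_iff.1 j.2))
  have hlt : Module.finrank ℝ (restrictTotalDegree σ ℝ (r * T + M * u.totalDegree)) <
      Module.finrank ℝ (Fin (M + 1) → restrictTotalDegree σ ℝ T) := by
    rw [Module.finrank_pi_fintype]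
    simp only [finrank_restrictTotalDegree, Finset.sum_const, Finset.card_univ, Fintype.card_fin,
      smul_eq_mul]
    exact (monomialCount_mul_add_le σ hr _ _).trans_lt hT
  obtain ⟨g, hg, hg0⟩ := (Submodule.ne_bot_iff _).1
    ((Ψ.codRestrict _ hmem).ker_ne_bot_of_finrank_lt hlt)
  refine ⟨fun j => g j, fun h => hg0 (funext fun j => Subtype.ext (congrFun h j)), ?_⟩
  rw [← hΨ]
  exact congrArg Subtype.val (LinearMap.mem_ker.1 hg)

/-- If `card σ` polynomials of degree at most `r` in `card σ` variables attain every value in a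
box at `k` points distinguished by the polynomial `u`, then `k ≤ r ^ card σ`. -/
theorem card_le_of_forall_box {σ : Type*} [Fintype σ] (f : σ → MvPolynomial σ ℝ) {r k : ℕ}
    (hr : 1 ≤ r) (hf : ∀ i, (f i).totalDegree ≤ r) (u : MvPolynomial σ ℝ) {δ : ℝ} (hδ : 0 < δ)
    (h : ∀ c : σ → ℝ, (∀ i, |c i| < δ) → ∃ x : Fin k → σ → ℝ,
      (∀ l i, eval (x l) (f i) = c i) ∧ Function.Injective fun l => eval (x l) u) :
    k ≤ r ^ Fintype.card σ := by
  obtain ⟨g, hg, hrel⟩ := exists_relation f hr hf u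
  obtain ⟨j, hj⟩ := Function.ne_iff.1 hg
  obtain ⟨c, hc, hcj⟩ : ∃ c : σ → ℝ, (∀ i, |c i| < δ) ∧ eval c (g j) ≠ 0 := by
    by_contra! hcon
    refine hj (funext_set (fun _ => Set.Ioo (-δ) δ) (fun _ => Set.Ioo_infinite (by linarith))
      fun x hx => ?_)
    rw [hcon x fun i => abs_lt.2 (hx i trivial)]
    simp
  obtain ⟨x, hx, hinj⟩ := h c hc
  let P : Polynomial ℝ := ∑ j : Fin (r ^ Fintype.card σ + 1),
    Polynomial.C (eval c (g j)) * Polynomial.X ^ (j : ℕ)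
  have hP : P ≠ 0 := by
    intro h0
    have := congrArg (fun p => Polynomial.coeff p j) h0
    simp [P, Polynomial.finsetSum_coeff, Polynomial.coeff_C_mul, Polynomial.coeff_X_pow,
      Fin.val_inj] at this
    exact hcj this
  have hdeg : P.natDegree ≤ r ^ Fintype.card σ :=
    Polynomial.natDegree_sum_le_of_forall_le _ _ fun j _ =>
      (Polynomial.natDegree_C_mul_X_pow_le _ _).trans (Nat.lt_succ_iff.1 j.2)
  have hroot : ∀ l, P.IsRoot (eval (x l) u) := by
    intro l
    have h1 := congrArg (eval (x l)) hrel
    have h2 : ∀ p, eval (x l) (bind₁ f p) = eval c p := by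
      intro p
      induction p using MvPolynomial.induction_on with
      | C a => simp
      | add p q hp hq => simp [hp, hq]
      | mul_X p i hp => simp [hp, hx]
    simpa [P, Polynomial.IsRoot, Polynomial.eval_finsetSum, h2] using h1
  classical
  calc k = (Finset.univ.image fun l => eval (x l) u).card := by
        rw [Finset.card_image_of_injective _ hinj, Finset.card_univ, Fintype.card_fin]
    _ ≤ P.natDegree := Polynomial.card_le_degree_of_subset_roots fun y hy => by
        obtain ⟨l, -, rfl⟩ := Finset.mem_image.1 (Finset.mem_val ▸ hy)
        exact (Polynomial.mem_roots hP).2 (hroot l)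
    _ ≤ _ := hdeg

theorem totalDegree_pderiv_le {σ : Type*} {P : MvPolynomial σ ℝ} {r : ℕ}
    (hP : P.totalDegree ≤ r + 1) (i : σ) : (pderiv i P).totalDegree ≤ r := by
  classical
  rw [totalDegree, Finset.sup_le_iff]
  intro m hm
  rw [mem_support_iff, coeff_pderiv] at hm
  have h1 := (le_totalDegree (mem_support_iff.2 (left_ne_zero_of_mul hm))).trans hP
  rw [Finsupp.sum_add_index' (by simp) (by simp), Finsupp.sum_single_index rfl] at h1
  omega

theorem hasDerivAt_eval_update {σ : Type*} [DecidableEq σ] (P : MvPolynomial σ ℝ) (x : σ → ℝ)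
    (i : σ) :
    HasDerivAt (fun t => eval (Function.update x i t) P) (eval x (pderiv i P)) (x i) := by
  induction P using MvPolynomial.induction_on with
  | C a => simpa using hasDerivAt_const (x i) a
  | add p q hp hq =>
    simp only [map_add]
    exact hp.add hq
  | mul_X p j hp =>
    have hX : HasDerivAt (fun t => Function.update x i t j) (eval x (pderiv i (X j))) (x i) := by
      by_cases hij : j = i
      · subst hij
        simp only [Function.update_self, pderiv_X_self, map_one]
        exact hasDerivAt_id (x j)
      · simpa [pderiv_X_of_ne hij, Function.update_of_ne hij] using hasDerivAt_const (x i) (x j)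
    have := hp.mul hX
    simp only [Function.update_eq_self] at this
    have hval : eval x (pderiv i (p * X j)) =
        eval x (pderiv i p) * x j + eval x p * eval x (pderiv i (X j)) := by
      simp only [Derivation.leibniz, smul_eq_mul, map_add, map_mul, eval_X]
      ring
    simp only [map_mul, eval_X] at hval ⊢
    rw [hval]
    exact this

theorem eval_pderiv_eq_zero_of_isLocalMin {σ : Type*} (P : MvPolynomial σ ℝ)
    {x : σ → ℝ} (hx : IsLocalMin (fun y => eval y P) x) (i : σ) : eval x (pderiv i P) = 0 := by
  classical
  refine IsLocalMin.hasDerivAt_eq_zero ?_ (hasDerivAt_eval_update P x i)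
  have hc : Tendsto (fun t => Function.update x i t) (𝓝 (x i)) (𝓝 x) := by
    have : Continuous fun t => Function.update x i t := by fun_prop
    simpa using this.tendsto (x i)
  simpa [IsLocalMin, IsMinFilter] using hc.eventually hx

/-- Polynomials are dense in the continuous functions on a compact set. -/
theorem exists_eval_near {σ : Type*} (K : Set (σ → ℝ)) [CompactSpace K]
    (g : C(K, ℝ)) {ε : ℝ} (hε : 0 < ε) :
    ∃ u : MvPolynomial σ ℝ, ∀ x : K, |eval (x : σ → ℝ) u - g x| < ε := by
  let coord : σ → C(K, ℝ) := fun i => ⟨fun x => x.1 i, (continuous_apply i).comp continuous_subtype_val⟩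
  have heval : ∀ (u : MvPolynomial σ ℝ) (x : K), aeval coord u x = eval (x : σ → ℝ) u := by
    intro u x
    induction u using MvPolynomial.induction_on with
    | C a => simp
    | add p q hp hq => simp [hp, hq]
    | mul_X p i hp => simp [hp, coord]
  have hsep : (aeval coord : MvPolynomial σ ℝ →ₐ[ℝ] C(K, ℝ)).range.SeparatesPoints := by
    intro x y hxy
    obtain ⟨i, hi⟩ := Function.ne_iff.1 (Subtype.coe_ne_coe.2 hxy)
    exact ⟨coord i, ⟨coord i, ⟨X i, by simp⟩, rfl⟩, hi⟩
  obtain ⟨⟨_, u, rfl⟩, hu⟩ :=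
    ContinuousMap.exists_mem_subalgebra_near_continuous_of_separatesPoints _ hsep g
      g.continuous ε hε
  exact ⟨u, fun x => by simpa [heval] using hu x⟩

/-- Points in distinct components of a compact Hausdorff space are distinguished by an
integer-valued continuous function. -/
theorem exists_continuous_int_separating {X : Type*} [TopologicalSpace X] [CompactSpace X]
    [T2Space X] {k : ℕ} (z : Fin k → X)
    (hz : Function.Injective fun l => (z l : ConnectedComponents X)) :
    ∃ g : C(X, ℝ), (∀ x, ∃ j : ℤ, g x = j) ∧ ∀ l, g (z l) = (l : ℕ) := by
  classical
  have hV : ∀ l, ∃ V : Set (ConnectedComponents X), IsClopen V ∧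
      (z l : ConnectedComponents X) ∈ V ∧
      V ⊆ {c | ∃ l', l' ≠ l ∧ c = (z l' : ConnectedComponents X)}ᶜ := by
    intro l
    have hfin : {c | ∃ l', l' ≠ l ∧ c = (z l' : ConnectedComponents X)}.Finite :=
      (Set.finite_range fun l => (z l : ConnectedComponents X)).subset (by
        rintro _ ⟨l', -, rfl⟩
        exact ⟨l', rfl⟩)
    refine compact_exists_isClopen_in_isOpen hfin.isClosed.isOpen_compl ?_
    rintro ⟨l', hne, heq⟩
    exact hne (hz heq).symm
  choose V hV hmem hsub using hV
  have hnot : ∀ l l', l' ≠ l → (z l' : ConnectedComponents X) ∉ V l := fun l l' hne h =>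
    hsub l h ⟨l', hne, rfl⟩
  refine ⟨⟨fun x => ∑ l, (V l).indicator (fun _ => ((l : ℕ) : ℝ)) (x : ConnectedComponents X),
    ?_⟩, fun x => ⟨∑ l, (V l).indicator (fun _ => ((l : ℕ) : ℤ)) (x : ConnectedComponents X), ?_⟩,
    fun l => ?_⟩
  · refine continuous_finsetSum _ fun l _ => ?_
    have hind : Continuous ((V l).indicator fun _ => ((l : ℕ) : ℝ)) :=
      continuous_const.indicator fun a ha => by simp [(hV l).frontier_eq] at ha
    exact hind.comp ConnectedComponents.continuous_coe
  · simp [Set.indicator_apply]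
  · simp only [ContinuousMap.coe_mk]
    rw [Finset.sum_eq_single l]
    · simp [hmem]
    · intro l' _ hne
      simp [hnot l' l hne.symm]
    · simp

/-- Near every prescribed component of its zero set, a small generic perturbation of a nonnegative
polynomial `F` has a local minimum; there are at most `r ^ card σ` critical points. -/
theorem le_of_injective_component_zeros {σ : Type*} [Fintype σ] {F : MvPolynomial σ ℝ}
    {r k : ℕ} (hr : 1 ≤ r) (hdeg : F.totalDegree ≤ r + 1) (hF : ∀ x, 0 ≤ eval x F)
    (z : Fin k → {x : σ → ℝ // eval x F = 0})
    (hz : Function.Injective fun l => (z l : ConnectedComponents {x : σ → ℝ // eval x F = 0})) :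
    k ≤ r ^ Fintype.card σ := by
  obtain ⟨R, hR1, hR⟩ : ∃ R : ℝ, 1 ≤ R ∧ ∀ l, ∑ i, (z l).1 i ^ 2 + 1 ≤ R := by
    refine ⟨∑ l, ∑ i, (z l).1 i ^ 2 + 1, ?_, fun l => ?_⟩
    · have : 0 ≤ ∑ l, ∑ i, (z l).1 i ^ 2 := by positivity
      linarith
    · have := Finset.single_le_sum (f := fun l => ∑ i, (z l).1 i ^ 2)
        (fun _ _ => by positivity) (Finset.mem_univ l)
      simpa using this
  have hFc : Continuous fun x => eval x F := F.continuous_eval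
  have hsq : Continuous fun x : σ → ℝ => ∑ i, x i ^ 2 := by fun_prop
  set B : Set (σ → ℝ) := {x | ∑ i, x i ^ 2 ≤ R} with hB
  have hBabs : ∀ x ∈ B, ∀ i, |x i| ≤ R := by
    intro x hx i
    have h1 : x i ^ 2 ≤ R := (Finset.single_le_sum (f := fun i => x i ^ 2)
      (fun _ _ => by positivity) (Finset.mem_univ i)).trans hx
    exact abs_le_of_sq_le_sq (by nlinarith) (by linarith)
  have hBcl : IsClosed B := isClosed_le hsq continuous_const
  have hBc : IsCompact B := by
    refine Metric.isCompact_of_isClosed_isBounded hBcl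
      ((Metric.isBounded_closedBall (x := 0) (r := R)).subset fun x hx => ?_)
    rw [mem_closedBall_zero_iff, pi_norm_le_iff_of_nonneg (by linarith)]
    exact hBabs x hx
  set K : Set (σ → ℝ) := B ∩ {x | eval x F = 0} with hK
  have : CompactSpace K := isCompact_iff_compactSpace.1
    (hBc.inter_right (isClosed_eq hFc continuous_const))
  let w : Fin k → K := fun l =>
    ⟨(z l).1, show ∑ i, (z l).1 i ^ 2 ≤ R by linarith [hR l], (z l).2⟩
  have hw : Function.Injective fun l => (w l : ConnectedComponents K) := by
    let ι : K → {x : σ → ℝ // eval x F = 0} := fun x => ⟨x.1, x.2.2⟩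
    have hι : Continuous ι := by fun_prop
    have hc : Continuous fun x => (ι x : ConnectedComponents {x : σ → ℝ // eval x F = 0}) :=
      ConnectedComponents.continuous_coe.comp hι
    exact Function.Injective.of_comp (f := hc.connectedComponentsLift) hz
  obtain ⟨g, hgint, hgw⟩ := exists_continuous_int_separating w hw
  obtain ⟨u, hu⟩ := exists_eval_near K g (ε := 1 / 4) (by norm_num)
  have huc : Continuous fun x => eval x u := u.continuous_eval
  obtain ⟨η, hη, hηF⟩ : ∃ η : ℝ, 0 < η ∧ ∀ x ∈ B, ∀ l : Fin k,
      |eval x u - (l : ℕ)| = 1 / 3 → η ≤ eval x F := by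
    have hcl : IsClosed {x : σ → ℝ | ∃ l : Fin k, |eval x u - (l : ℕ)| = 1 / 3} := by
      simp only [Set.ofPred_exists]
      exact isClosed_iUnion_of_finite fun l => isClosed_eq (by fun_prop) continuous_const
    obtain ⟨η, hη, h⟩ := (hBc.inter_right hcl).exists_forall_le' (a := 0) hFc.continuousOn (by
      rintro x ⟨hxB, l, hl⟩
      refine lt_of_le_of_ne (hF x) fun h0 => ?_
      obtain ⟨j, hj⟩ := hgint ⟨x, hxB, h0.symm⟩
      have h1 := hu ⟨x, hxB, h0.symm⟩
      rw [hj] at h1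
      have h2 : |((j - (l : ℕ) : ℤ) : ℝ)| < 1 := by
        push_cast
        rw [abs_lt] at *
        have := abs_le.1 hl.le
        constructor <;> linarith
      have h3 : j - (l : ℕ) = 0 := by
        rw [← Int.abs_lt_one_iff]
        exact_mod_cast h2
      have h4 : j = (l : ℕ) := by omega
      rw [h4] at h1
      simp only [Int.cast_natCast] at h1
      linarith)
    exact ⟨η, hη, fun x hx l hl => h x ⟨hx, l, hl⟩⟩
  set ε := η / (2 * R) with hε
  have hε0 : 0 < ε := by positivity
  have hεR : ε * R = η / 2 := by rw [hε]; field_simp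
  set m : ℝ := (Fintype.card σ : ℝ) with hm
  have hm0 : 0 ≤ m := by positivity
  set δ := ε / (2 * m * R + 1) with hδ
  have hδ0 : 0 < δ := by positivity
  have hδε : 2 * (m * (δ * R)) < ε := by
    have : δ * (2 * m * R + 1) = ε := by rw [hδ]; field_simp
    nlinarith
  let Φ : MvPolynomial σ ℝ := F + C ε * ∑ i, X i ^ 2
  have hΦdeg : Φ.totalDegree ≤ r + 1 := by
    refine (totalDegree_add _ _).trans (max_le hdeg ((totalDegree_mul _ _).trans ?_))
    rw [totalDegree_C, zero_add]
    exact totalDegree_finsetSum_le fun i _ => by rw [totalDegree_X_pow]; omega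
  refine card_le_of_forall_box (fun i => pderiv i Φ) hr (fun i => totalDegree_pderiv_le hΦdeg i)
    u hδ0 fun c hc => ?_
  have hlin : ∀ x ∈ B, |∑ i, c i * x i| ≤ m * (δ * R) := by
    intro x hx
    refine (Finset.abs_sum_le_sum_abs _ _).trans ?_
    rw [hm, ← nsmul_eq_mul]
    refine Finset.sum_le_card_nsmul _ _ _ fun i _ => ?_
    rw [abs_mul]
    exact mul_le_mul (hc i).le (hBabs x hx i) (abs_nonneg _) hδ0.le
  let Θ : MvPolynomial σ ℝ := Φ - ∑ i, C (c i) * X i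
  have hΘ : ∀ x, eval x Θ = eval x F + ε * ∑ i, x i ^ 2 - ∑ i, c i * x i := fun x => by
    simp [Θ, Φ]
  have hmin : ∀ l : Fin k, ∃ x : σ → ℝ, (∀ i, eval x (pderiv i Φ) = c i) ∧
      |eval x u - (l : ℕ)| < 1 / 3 := by
    intro l
    have hwB : (z l).1 ∈ B := (w l).2.1
    have hwu : |eval (z l).1 u - (l : ℕ)| < 1 / 4 := by
      have := hu (w l)
      rwa [hgw] at this
    have hwu' : |eval (z l).1 u - (l : ℕ)| ≤ 1 / 3 := by linarith
    obtain ⟨x, ⟨hxB, hxu⟩, hx⟩ := (hBc.inter_right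
      (isClosed_le (f := fun x => |eval x u - (l : ℕ)|) (by fun_prop)
        (continuous_const (y := (1 / 3 : ℝ))))).exists_isMinOn
      ⟨(z l).1, hwB, hwu'⟩ Θ.continuous_eval.continuousOn
    have hle : eval x Θ ≤ eval (z l).1 Θ :=
      hx ⟨hwB, hwu'⟩
    rw [hΘ, hΘ, (z l).2] at hle
    have h1 := abs_le.1 (hlin x hxB)
    have h2 := abs_le.1 (hlin _ hwB)
    have h3 : ε * (∑ i, (z l).1 i ^ 2 + 1) ≤ ε * R := mul_le_mul_of_nonneg_left (hR l) hε0.le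
    have hxR : ∑ i, x i ^ 2 < R := by
      refine lt_of_le_of_ne hxB fun h => ?_
      rw [h] at hle
      linarith [hF x]
    have hxu' : |eval x u - (l : ℕ)| < 1 / 3 := by
      refine lt_of_le_of_ne hxu fun h => ?_
      have h4 := hηF x hxB l h
      have h5 : 0 ≤ ε * ∑ i, x i ^ 2 := by positivity
      linarith
    refine ⟨x, fun i => ?_, hxu'⟩
    have hloc : IsLocalMin (fun y => eval y Θ) x := by
      refine hx.isLocalMin (Filter.inter_mem ?_ ?_)
      · filter_upwards [(isOpen_lt hsq continuous_const).mem_nhds hxR] with y hy using le_of_lt hy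
      · filter_upwards [(isOpen_lt (f := fun x => |eval x u - (l : ℕ)|) (by fun_prop)
          (continuous_const (y := (1 / 3 : ℝ)))).mem_nhds hxu'] with y hy using le_of_lt hy
    classical
    have h6 := eval_pderiv_eq_zero_of_isLocalMin Θ hloc i
    have h7 : pderiv i (∑ j, C (c j) * X j : MvPolynomial σ ℝ) = C (c i) := by
      simp [pderiv_X, Pi.single_apply]
    simp only [Θ, map_sub, h7, eval_C] at h6
    linarith
  choose x hx hxu using hmin
  refine ⟨x, hx, fun l l' h => ?_⟩
  have h1 := abs_lt.1 (hxu l)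
  have h2 := abs_lt.1 (hxu l')
  simp only at h
  rw [h] at h1
  have h3 : |((l : ℕ) : ℤ) - ((l' : ℕ) : ℤ)| < 1 := by
    have : |((l : ℕ) : ℝ) - ((l' : ℕ) : ℝ)| < 1 := abs_lt.2 ⟨by linarith, by linarith⟩
    exact_mod_cast this
  rw [Int.abs_lt_one_iff] at h3
  exact Fin.ext (by omega)

/-- The zero set of a nonnegative polynomial of degree at most `r + 1` in `m` variables has at
most `r ^ m` connected components. -/
theorem components_zeros_le {σ : Type*} [Fintype σ] {F : MvPolynomial σ ℝ}
    {r : ℕ} (hr : 1 ≤ r) (hdeg : F.totalDegree ≤ r + 1) (hF : ∀ x, 0 ≤ eval x F) :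
    Finite (ConnectedComponents {x : σ → ℝ // eval x F = 0}) ∧
      Nat.card (ConnectedComponents {x : σ → ℝ // eval x F = 0}) ≤ r ^ Fintype.card σ := by
  have key : ∀ (k : ℕ) (e : Fin k ↪ ConnectedComponents {x : σ → ℝ // eval x F = 0}),
      k ≤ r ^ Fintype.card σ := by
    intro k e
    choose z hz using fun l => ConnectedComponents.surjective_coe (e l)
    exact le_of_injective_component_zeros hr hdeg hF z (by simpa [hz] using e.injective)
  have hfin : Finite (ConnectedComponents {x : σ → ℝ // eval x F = 0}) := by
    by_contra h
    rw [not_finite_iff_infinite] at h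
    have := key (r ^ Fintype.card σ + 1) (Fin.valEmbedding.trans (Infinite.natEmbedding _))
    omega
  exact ⟨hfin, key _ (Finite.equivFin _).symm.toEmbedding⟩

/-- A continuous surjection does not increase the number of connected components. -/
theorem components_le_of_surjective {X Y : Type*} [TopologicalSpace X] [TopologicalSpace Y]
    {f : X → Y} (hf : Continuous f) (hsurj : Function.Surjective f) {b : ℕ}
    (hX : Finite (ConnectedComponents X) ∧ Nat.card (ConnectedComponents X) ≤ b) :
    Finite (ConnectedComponents Y) ∧ Nat.card (ConnectedComponents Y) ≤ b := by
  obtain ⟨hfin, hcard⟩ := hX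
  have hc : Continuous fun x => (f x : ConnectedComponents Y) :=
    ConnectedComponents.continuous_coe.comp hf
  have hs : Function.Surjective hc.connectedComponentsLift :=
    Function.Surjective.of_comp (g := ((↑) : X → ConnectedComponents X))
      (ConnectedComponents.surjective_coe.comp hsurj)
  exact ⟨Finite.of_surjective _ hs, (Nat.card_le_card_of_surjective _ hs).trans hcard⟩

/-- An affine subspace of `ℝ^N` is the solution set of `N` affine equations. -/
theorem exists_matrix_mem_iff {N : ℕ} (L : AffineSubspace ℝ (EuclideanSpace ℝ (Fin N)))
    (hL : (L : Set (EuclideanSpace ℝ (Fin N))).Nonempty) :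
    ∃ (A : Matrix (Fin N) (Fin N) ℝ) (b : Fin N → ℝ), ∀ y : EuclideanSpace ℝ (Fin N),
      y ∈ L ↔ ∀ i, ∑ j, A i j * (y j - b j) = 0 := by
  obtain ⟨b, hb⟩ := hL
  let φ : (Fin N → ℝ) →ₗ[ℝ] (Fin N → ℝ) := (WithLp.linearEquiv 2 ℝ (Fin N → ℝ)).toLinearMap ∘ₗ
    (L.directionᗮ.starProjection : EuclideanSpace ℝ (Fin N) →ₗ[ℝ] EuclideanSpace ℝ (Fin N)) ∘ₗ
      (WithLp.linearEquiv 2 ℝ (Fin N → ℝ)).symm.toLinearMap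
  refine ⟨LinearMap.toMatrix' φ, b, fun y => ?_⟩
  have h1 : y ∈ L ↔ φ (fun j => y j - b j) = 0 := by
    have h2 : φ (fun j => y j - b j) = WithLp.ofLp (L.directionᗮ.starProjection (y - b)) := rfl
    rw [h2, WithLp.ofLp_eq_zero, Submodule.starProjection_apply_eq_zero_iff,
      Submodule.orthogonal_orthogonal, ← vsub_eq_sub,
      AffineSubspace.vsub_right_mem_direction_iff_mem hb]
  rw [h1, ← LinearMap.toMatrix'_mulVec, funext_iff]
  rfl

section RationalMap

variable {n N : ℕ} (p q : Fin N → MvPolynomial (Fin n) ℝ)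
  (A : Matrix (Fin N) (Fin N) ℝ) (b : Fin N → ℝ)

/-- The `i`-th affine equation at the point `p / q`, with denominators cleared. -/
noncomputable def clearedEquation (i : Fin N) : MvPolynomial (Fin n) ℝ :=
  ∑ j, C (A i j) * ((p j - C (b j) * q j) * ∏ k ∈ Finset.univ.erase j, q k)

/-- The nonnegative polynomial whose zeros are the pairs `(x, t)` such that `p x / q x` satisfies
the affine equations and `t` is the inverse of the product of the denominators. -/
noncomputable def incidencePolynomial : MvPolynomial (Option (Fin n)) ℝ :=
  ∑ i, rename some (clearedEquation p q A b i) ^ 2 + (X none * rename some (∏ j, q j) - 1) ^ 2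

theorem totalDegree_clearedEquation_le {d : ℕ} (hp : ∀ i, (p i).totalDegree ≤ d)
    (hq : ∀ i, (q i).totalDegree ≤ d) (i : Fin N) :
    (clearedEquation p q A b i).totalDegree ≤ N * d := by
  refine totalDegree_finsetSum_le fun j _ => (totalDegree_mul _ _).trans ?_
  rw [totalDegree_C, zero_add]
  have h1 : (p j - C (b j) * q j).totalDegree ≤ d := by
    refine (totalDegree_sub _ _).trans (max_le (hp j) ((totalDegree_mul _ _).trans ?_))
    rw [totalDegree_C, zero_add]
    exact hq j
  have h2 : (∏ k ∈ Finset.univ.erase j, q k).totalDegree ≤ (N - 1) * d := by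
    refine (totalDegree_finsetProd _ _).trans ?_
    simpa using Finset.sum_le_card_nsmul (Finset.univ.erase j) _ d fun k _ => hq k
  have hN : N = N - 1 + 1 := by have := j.2; omega
  calc _ ≤ d + (N - 1) * d := (totalDegree_mul _ _).trans (add_le_add h1 h2)
    _ = (N - 1 + 1) * d := by ring
    _ = N * d := by rw [← hN]

theorem totalDegree_incidencePolynomial_le {d : ℕ} (hp : ∀ i, (p i).totalDegree ≤ d)
    (hq : ∀ i, (q i).totalDegree ≤ d) :
    (incidencePolynomial p q A b).totalDegree ≤ 2 * N * d + 1 + 1 := by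
  refine (totalDegree_add _ _).trans (max_le ?_ ?_)
  · refine totalDegree_finsetSum_le fun i _ => (totalDegree_pow _ _).trans ?_
    have := (totalDegree_rename_le some _).trans (totalDegree_clearedEquation_le p q A b hp hq i)
    linarith
  · refine (totalDegree_pow _ _).trans ?_
    have h1 : (∏ j, q j).totalDegree ≤ N * d := by
      refine (totalDegree_finsetProd _ _).trans ?_
      simpa using Finset.sum_le_card_nsmul Finset.univ _ d fun k _ => hq k
    have h2 : (X none * rename some (∏ j, q j) - 1 :
        MvPolynomial (Option (Fin n)) ℝ).totalDegree ≤ 1 + N * d := by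
      refine (totalDegree_sub _ _).trans (max_le ((totalDegree_mul _ _).trans ?_) (by simp))
      rw [totalDegree_X]
      exact add_le_add le_rfl ((totalDegree_rename_le some _).trans h1)
    linarith

theorem eval_incidencePolynomial (z : Option (Fin n) → ℝ) :
    eval z (incidencePolynomial p q A b) =
      ∑ i, eval (z ∘ some) (clearedEquation p q A b i) ^ 2 +
        (z none * ∏ j, eval (z ∘ some) (q j) - 1) ^ 2 := by
  simp [incidencePolynomial, eval_rename, map_prod]

theorem eval_clearedEquation {x : Fin n → ℝ} (hx : ∀ j, eval x (q j) ≠ 0) (i : Fin N) :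
    eval x (clearedEquation p q A b i) =
      (∏ j, eval x (q j)) * ∑ j, A i j * (ratMap p q x j - b j) := by
  simp only [clearedEquation, map_sum, map_mul, map_sub, eval_C, eval_prod, Finset.mul_sum]
  refine Finset.sum_congr rfl fun j _ => ?_
  rw [← Finset.mul_prod_erase _ _ (Finset.mem_univ j)]
  have hj := hx j
  simp only [ratMap]
  field_simp

theorem eval_incidencePolynomial_eq_zero_iff (z : Option (Fin n) → ℝ) :
    eval z (incidencePolynomial p q A b) = 0 ↔
      (∀ j, eval (z ∘ some) (q j) ≠ 0) ∧
      (∀ i, ∑ j, A i j * (ratMap p q (z ∘ some) j - b j) = 0) ∧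
      z none * ∏ j, eval (z ∘ some) (q j) = 1 := by
  rw [eval_incidencePolynomial, add_eq_zero_iff_of_nonneg (by positivity) (by positivity),
    Finset.sum_eq_zero_iff_of_nonneg (fun _ _ => by positivity)]
  simp only [Finset.mem_univ, true_implies, sq_eq_zero_iff, sub_eq_zero]
  constructor
  · rintro ⟨h1, h2⟩
    have hQ : ∏ j, eval (z ∘ some) (q j) ≠ 0 := right_ne_zero_of_mul_eq_one h2
    have hq := fun j => Finset.prod_ne_zero_iff.1 hQ j (Finset.mem_univ j)
    refine ⟨hq, fun i => ?_, h2⟩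
    have h3 := h1 i
    rw [eval_clearedEquation p q A b hq] at h3
    exact (mul_eq_zero.1 h3).resolve_left hQ
  · rintro ⟨hq, h1, h2⟩
    exact ⟨fun i => by rw [eval_clearedEquation p q A b hq, h1, mul_zero], h2⟩

end RationalMap

/-- The intersection of the image of a rational map whose numerators and
denominators have degree at most `d` with any affine subspace has at most
`(2Nd+1)^(n+1)` connected components. -/
theorem image_ratMap_inter_affine_components (n N d : ℕ)
    (hn : 1 ≤ n) (hN : 1 ≤ N) (hd : 1 ≤ d)
    (p q : Fin N → MvPolynomial (Fin n) ℝ)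
    (hp : ∀ i, (p i).totalDegree ≤ d) (hq : ∀ i, (q i).totalDegree ≤ d)
    (L : AffineSubspace ℝ (EuclideanSpace ℝ (Fin N)))
    (hL : (L : Set (EuclideanSpace ℝ (Fin N))).Nonempty) :
    Finite (ConnectedComponents
      ↥(ratMap p q '' {x : Fin n → ℝ | ∀ i, MvPolynomial.eval x (q i) ≠ 0}
        ∩ (L : Set (EuclideanSpace ℝ (Fin N))))) ∧
    Nat.card (ConnectedComponents
      ↥(ratMap p q '' {x : Fin n → ℝ | ∀ i, MvPolynomial.eval x (q i) ≠ 0}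
        ∩ (L : Set (EuclideanSpace ℝ (Fin N)))))
      ≤ (2 * N * d + 1) ^ (n + 1) := by
  obtain ⟨A, b, hAb⟩ := exists_matrix_mem_iff L hL
  have hbound := components_zeros_le (F := incidencePolynomial p q A b) (r := 2 * N * d + 1)
    (by omega) (totalDegree_incidencePolynomial_le p q A b hp hq) (fun z => by
      rw [eval_incidencePolynomial]
      positivity)
  rw [Fintype.card_option, Fintype.card_fin] at hbound
  have hzero := eval_incidencePolynomial_eq_zero_iff p q A b
  refine components_le_of_surjective
    (f := fun z => ⟨ratMap p q (z.1 ∘ some), ⟨_, ((hzero _).1 z.2).1, rfl⟩,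
      (hAb _).2 ((hzero _).1 z.2).2.1⟩) ?_ ?_ hbound
  · refine Continuous.subtype_mk ((PiLp.continuous_toLp 2 _).comp (continuous_pi fun i => ?_)) _
    have hz : Continuous fun z : {z : Option (Fin n) → ℝ //
        eval z (incidencePolynomial p q A b) = 0} => z.1 ∘ some :=
      continuous_pi fun j => (continuous_apply (some j)).comp continuous_subtype_val
    exact ((p i).continuous_eval.comp hz).div ((q i).continuous_eval.comp hz)
      fun z => ((hzero _).1 z.2).1 i
  · rintro ⟨_, ⟨x, hx, rfl⟩, hxL⟩
    let z : Option (Fin n) → ℝ := fun o => o.elim (∏ j, eval x (q j))⁻¹ x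
    have hz : z ∘ some = x := rfl
    refine ⟨⟨z, (hzero z).2 ⟨hx, (hAb _).1 hxL, ?_⟩⟩, rfl⟩
    exact inv_mul_cancel₀ (Finset.prod_ne_zero_iff.2 fun j _ => hx j)
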